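/- Let a, d, n be positive integers with gcd(a, d) = 1 and n > 1, and let M = {a, a + d, a + 2d, …, a + (n−1)d}. Then μ(M) = (2a + (n−1)(d−1))/(2(2a + (n−1)d)) if d is odd, and μ(M) = 1/2 if d is even. -/

import Mathlib

open Filter Set Pointwise

/-- `countBelow S x` is the number of elements `n ∈ S` with `n ≤ x`. -/
noncomputable def countBelow (S : Set ℕ) (x : ℕ) : ℕ := (S ∩ Set.Iic x).ncard

/-- The upper asymptotic density `δ̄(S) = limsup_{x→∞} S(x)/x` of a set `S ⊆ ℕ`. -/
noncomputable def upperDensity (S : Set ℕ) : ℝ :=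
  Filter.limsup (fun x : ℕ => (countBelow S x : ℝ) / x) Filter.atTop

/-- `S` is an `M`-set: for all `a, b ∈ S`, the difference `a - b` does not lie in `M`. -/
def IsMSet (M S : Set ℕ) : Prop := ∀ a ∈ S, ∀ b ∈ S, a - b ∉ M

/-- Motzkin's quantity `μ(M)`: the supremum of the upper densities of all `M`-sets. -/
noncomputable def muM (M : Set ℕ) : ℝ :=
  sSup {x : ℝ | ∃ S : Set ℕ, IsMSet M S ∧ x = upperDensity S}

lemma countBelow_eq_count (S : Set ℕ) [DecidablePred (· ∈ S)] (x : ℕ) :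
    countBelow S x = Nat.count (· ∈ S) (x + 1) := by
  rw [countBelow, Nat.count_eq_card_filter_range, ← Set.ncard_coe_finset]
  congr 1
  ext y
  simp [and_comm]

lemma count_mul_le (S : Set ℕ) [DecidablePred (· ∈ S)] (L s : ℕ)
    (h : ∀ b, Nat.count (fun i => b + i ∈ S) L ≤ s) (k : ℕ) :
    Nat.count (· ∈ S) (k * L) ≤ k * s := by
  induction k with
  | zero => simp
  | succ k ih =>
    rw [Nat.succ_mul, Nat.count_add, Nat.succ_mul]
    exact Nat.add_le_add ih (h _)

lemma le_count_mul (S : Set ℕ) [DecidablePred (· ∈ S)] (L s : ℕ)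
    (h : ∀ k, s ≤ Nat.count (fun i => k * L + i ∈ S) L) (k : ℕ) :
    k * s ≤ Nat.count (· ∈ S) (k * L) := by
  induction k with
  | zero => simp
  | succ k ih =>
    rw [Nat.succ_mul k s, Nat.succ_mul k L, Nat.count_add]
    exact Nat.add_le_add ih (h _)

lemma countBelow_div_le_two (S : Set ℕ) (x : ℕ) : (countBelow S x : ℝ) / x ≤ 2 := by
  classical
  rcases Nat.eq_zero_or_pos x with rfl | hx
  · simp
  · rw [countBelow_eq_count, div_le_iff₀ (by positivity)]
    have := Nat.count_le (p := (· ∈ S)) (n := x + 1)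
    exact_mod_cast (by omega : Nat.count (· ∈ S) (x + 1) ≤ 2 * x)

/-- If every window of length `L` meets `S` in at most `s` points, the upper density is at most
`s / L`. -/
lemma upperDensity_le (S : Set ℕ) [DecidablePred (· ∈ S)] (L s : ℕ) (hL : 0 < L)
    (h : ∀ b, Nat.count (fun i => b + i ∈ S) L ≤ s) : upperDensity S ≤ (s : ℝ) / L := by
  have hlim : Tendsto (fun x : ℕ => (s : ℝ) / L + (s : ℝ) / x) atTop (nhds ((s : ℝ) / L)) := by
    simpa using (tendsto_const_nhds (x := (s : ℝ) / L)).add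
      (tendsto_const_div_atTop_nhds_zero_nat (s : ℝ))
  rw [upperDensity, ← hlim.limsup_eq]
  refine limsup_le_limsup ?_ ?_ hlim.isBoundedUnder_le
  · filter_upwards [eventually_gt_atTop 0] with x hx
    have h1 : countBelow S x ≤ (x / L + 1) * s := by
      rw [countBelow_eq_count]
      refine (Nat.count_monotone _ ?_).trans (count_mul_le S L s h _)
      have := Nat.lt_div_mul_add (a := x) hL
      rw [Nat.succ_mul]; omega
    have h2 : ((x / L : ℕ) : ℝ) ≤ (x : ℝ) / L := Nat.cast_div_le
    have hx' : (0 : ℝ) < x := by exact_mod_cast hx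
    have hL' : (0 : ℝ) < L := by exact_mod_cast hL
    rw [div_le_iff₀ hx']
    calc (countBelow S x : ℝ) ≤ ((x / L : ℕ) + 1) * s := by exact_mod_cast h1
      _ ≤ ((x : ℝ) / L + 1) * s := by gcongr
      _ = ((s : ℝ) / L + s / x) * x := by field_simp
  · exact IsBoundedUnder.isCoboundedUnder_le
      ⟨0, Filter.eventually_map.2 (Eventually.of_forall fun x => by positivity)⟩

/-- If every window `[kL, (k + 1)L)` meets `S` in at least `s` points, the upper density is at
least `s / L`. -/
lemma le_upperDensity (S : Set ℕ) [DecidablePred (· ∈ S)] (L s : ℕ) (hL : 0 < L)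
    (h : ∀ k, s ≤ Nat.count (fun i => k * L + i ∈ S) L) : (s : ℝ) / L ≤ upperDensity S := by
  have hlim : Tendsto (fun x : ℕ => (s : ℝ) / L - (s : ℝ) / x) atTop (nhds ((s : ℝ) / L)) := by
    simpa using (tendsto_const_nhds (x := (s : ℝ) / L)).sub
      (tendsto_const_div_atTop_nhds_zero_nat (s : ℝ))
  rw [upperDensity, ← hlim.limsup_eq]
  refine limsup_le_limsup ?_ hlim.isCoboundedUnder_le
    ⟨2, Filter.eventually_map.2 (Eventually.of_forall fun x => countBelow_div_le_two S x)⟩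
  filter_upwards [eventually_gt_atTop 0] with x hx
  have h1 : (x / L) * s ≤ countBelow S x := by
    rw [countBelow_eq_count]
    refine (le_count_mul S L s h _).trans (Nat.count_monotone _ ?_)
    exact (Nat.div_mul_le_self x L).trans (Nat.le_succ x)
  have hx' : (0 : ℝ) < x := by exact_mod_cast hx
  have hL' : (0 : ℝ) < L := by exact_mod_cast hL
  have h2 : (x : ℝ) / L ≤ (x / L : ℕ) + 1 := by
    rw [div_le_iff₀ hL']
    have := Nat.lt_div_mul_add (a := x) hL
    exact_mod_cast (by rw [Nat.succ_mul]; omega : x ≤ (x / L + 1) * L)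
  rw [le_div_iff₀ hx']
  calc ((s : ℝ) / L - s / x) * x = ((x : ℝ) / L - 1) * s := by field_simp
    _ ≤ ((x / L : ℕ) : ℝ) * s := by gcongr; linarith
    _ ≤ countBelow S x := by exact_mod_cast h1

lemma muM_eq_of_windows (M : Set ℕ) (L s : ℕ) (hL : 0 < L)
    (hub : ∀ S : Set ℕ, ∀ _ : DecidablePred (· ∈ S), IsMSet M S →
      ∀ b, Nat.count (fun i => b + i ∈ S) L ≤ s)
    (S₀ : Set ℕ) [DecidablePred (· ∈ S₀)] (hS₀ : IsMSet M S₀)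
    (hlb : ∀ k, s ≤ Nat.count (fun i => k * L + i ∈ S₀) L) : muM M = (s : ℝ) / L := by
  classical
  refine IsGreatest.csSup_eq ⟨⟨S₀, hS₀, le_antisymm (le_upperDensity S₀ L s hL hlb)
    (upperDensity_le S₀ L s hL (hub S₀ inferInstance hS₀))⟩, ?_⟩
  rintro _ ⟨S, hS, rfl⟩
  exact upperDensity_le S L s hL (hub S inferInstance hS)

/-- An `M`-set meets every window of length `2m`, `m ∈ M`, in at most `m` points. -/
lemma IsMSet.count_two_mul_le {M S : Set ℕ} [DecidablePred (· ∈ S)] (hS : IsMSet M S) {m : ℕ}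
    (hm : m ∈ M) (b : ℕ) : Nat.count (fun i => b + i ∈ S) (2 * m) ≤ m := by
  rw [Nat.count_eq_card_filter_range]
  conv_rhs => rw [← Finset.card_range m]
  refine Finset.card_le_card_of_injOn (fun i => if i < m then i else i - m) ?_ ?_
  · intro i hi
    simp only [Finset.coe_filter, Finset.mem_range, Set.mem_ofPred_eq, Finset.coe_range,
      Set.mem_Iio] at hi ⊢
    split_ifs <;> omega
  · intro i hi j hj hij
    simp only [Finset.coe_filter, Finset.mem_range, Set.mem_ofPred_eq] at hi hj hij
    have h1 : b + i - (b + j) ≠ m := fun e => hS _ hi.2 _ hj.2 (e ▸ hm)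
    have h2 : b + j - (b + i) ≠ m := fun e => hS _ hj.2 _ hi.2 (e ▸ hm)
    split_ifs at hij <;> omega

/-- Multiplication by a unit followed by a translation permutes the residues modulo `L`. -/
lemma injOn_add_mul_mod {d L : ℕ} (h : Nat.Coprime L d) (c : ℕ) :
    Set.InjOn (fun j => (c + d * j) % L) (Finset.range L) := by
  intro i hi j hj hij
  simp only [Finset.coe_range, Set.mem_Iio] at hi hj
  have h1 : c + d * i ≡ c + d * j [MOD L] := hij
  exact ((Nat.ModEq.cancel_left_of_coprime h
    (Nat.ModEq.add_left_cancel' c h1))).eq_of_lt_of_lt hi hj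

section OddDifference

variable {a d n s L t : ℕ}

/-- Modulo `L = 2a + (n - 1)d`, no two points of a window of length `L` of an `M`-set have
difference `d * (s + k)` with `k < n`, because `d * s ≡ a`. -/
lemma IsMSet.not_mem_window {S : Set ℕ}
    (hS : IsMSet {m | ∃ k < n, m = a + k * d} S) (hLa : L = 2 * a + (n - 1) * d)
    (hds : d * s = t * L + a) {b c i j : ℕ} (hL : 0 < L) (hij : i + s ≤ j) (hji : j < i + s + n)
    (hi : b + (c + d * i) % L ∈ S) : b + (c + d * j) % L ∉ S := by
  intro hj
  obtain ⟨k, rfl⟩ := Nat.exists_eq_add_of_le hij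
  have hk : k < n := by omega
  set u := (c + d * i) % L with hu
  set v := (c + d * (i + s + k)) % L with hv
  have hul : u < L := Nat.mod_lt _ hL
  have hvl : v < L := Nat.mod_lt _ hL
  have hcong : v ≡ u + (a + k * d) [MOD L] := by
    have e : c + d * (i + s + k) = (c + d * i + (a + k * d)) + L * t := by
      linear_combination hds
    calc v ≡ c + d * (i + s + k) [MOD L] := Nat.mod_modEq _ _
      _ ≡ c + d * i + (a + k * d) [MOD L] := by
        rw [e]; simp [Nat.ModEq]
      _ ≡ u + (a + k * d) [MOD L] := (Nat.mod_modEq _ _).symm.add_right _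
  obtain ⟨l, hl⟩ : ∃ l, n - 1 = k + l := Nat.exists_eq_add_of_le (by omega)
  have hLs : L = (a + k * d) + (a + l * d) := by rw [hLa, hl]; ring
  rcases lt_or_ge (u + (a + k * d)) L with hlt | hge
  · have := hcong.eq_of_lt_of_lt hvl hlt
    exact hS _ hj _ hi ⟨k, hk, by omega⟩
  · have h2 : v ≡ u + (a + k * d) - L [MOD L] := by
      refine hcong.trans ?_
      conv_lhs => rw [← Nat.sub_add_cancel hge]
      simp [Nat.ModEq]
    have := h2.eq_of_lt_of_lt hvl (by omega)
    exact hS _ hi _ hj ⟨l, by omega, by omega⟩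

lemma IsMSet.count_le {S : Set ℕ} [DecidablePred (· ∈ S)]
    (hS : IsMSet {m | ∃ k < n, m = a + k * d} S) (hn : 0 < n) (hL : 0 < L)
    (hLa : L = 2 * a + (n - 1) * d) (hLs : L = 2 * s + (n - 1)) (hds : d * s = t * L + a)
    (hcop : Nat.Coprime L d) (b : ℕ) : Nat.count (fun i => b + i ∈ S) L ≤ s := by
  rw [Nat.count_eq_card_filter_range]
  rcases Finset.eq_empty_or_nonempty ((Finset.range L).filter fun i => b + i ∈ S) with he | ⟨c, hc⟩
  · simp [he]
  simp only [Finset.mem_filter, Finset.mem_range] at hc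
  have hinj := injOn_add_mul_mod hcop c
  have himg : (Finset.range L).image (fun j => (c + d * j) % L) = Finset.range L := by
    refine Finset.eq_of_subset_of_card_le ?_ (Finset.card_image_of_injOn hinj).ge
    intro x hx
    obtain ⟨j, -, rfl⟩ := Finset.mem_image.1 hx
    exact Finset.mem_range.2 (Nat.mod_lt _ hL)
  have hzero : b + (c + d * 0) % L ∈ S := by
    simpa [Nat.mod_eq_of_lt hc.1] using hc.2
  rw [← himg, Finset.filter_image]
  refine Finset.card_image_le.trans ?_
  conv_rhs => rw [← Finset.card_range s]
  refine Finset.card_le_card_of_injOn (fun j => if j < s then j else j - (s + n - 1)) ?_ ?_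
  · intro j hj
    simp only [Finset.coe_filter, Finset.mem_range, Set.mem_ofPred_eq, Finset.coe_range,
      Set.mem_Iio] at hj ⊢
    have : ¬ (0 + s ≤ j ∧ j < 0 + s + n) := fun h =>
      hS.not_mem_window hLa hds hL h.1 h.2 hzero hj.2
    split_ifs <;> omega
  · intro i hi j hj hij
    simp only [Finset.coe_filter, Finset.mem_range, Set.mem_ofPred_eq] at hi hj hij
    have h0 : ∀ i, b + (c + d * i) % L ∈ S → ¬ (0 + s ≤ i ∧ i < 0 + s + n) := fun i hi h =>
      hS.not_mem_window hLa hds hL h.1 h.2 hzero hi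
    have h1 : ¬ (i + s ≤ j ∧ j < i + s + n) := fun h =>
      hS.not_mem_window hLa hds hL h.1 h.2 hi.2 hj.2
    have h2 : ¬ (j + s ≤ i ∧ i < j + s + n) := fun h =>
      hS.not_mem_window hLa hds hL h.1 h.2 hj.2 hi.2
    have h3 := h0 i hi.2
    have h4 := h0 j hj.2
    split_ifs at hij <;> omega

lemma isMSet_residues (ha : 0 < a) (hLs : L = 2 * s + (n - 1)) (hds : d * s = t * L + a)
    (hcop : Nat.Coprime L d) :
    IsMSet {m | ∃ k < n, m = a + k * d} {x | ∃ i < s, x ≡ d * i [MOD L]} := by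
  rintro x ⟨i, hi, hx⟩ y ⟨j, hj, hy⟩ ⟨k, hk, hxy⟩
  have hxe : x = y + (a + k * d) := by omega
  have h1 : d * i ≡ d * (j + s + k) [MOD L] := by
    have e : d * (j + s + k) = (d * j + (a + k * d)) + L * t := by linear_combination hds
    calc d * i ≡ x [MOD L] := hx.symm
      _ ≡ d * j + (a + k * d) [MOD L] := hxe ▸ hy.add_right _
      _ ≡ d * (j + s + k) [MOD L] := by rw [e]; simp [Nat.ModEq]
  have h2 : i ≡ j + s + k [MOD L] := Nat.ModEq.cancel_left_of_coprime hcop h1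
  have h3 := (Nat.modEq_iff_dvd' (by omega)).1 h2
  exact absurd (Nat.le_of_dvd (by omega) h3) (by omega)

lemma le_count_residues (hL : 0 < L) (hsL : s ≤ L) (hcop : Nat.Coprime L d)
    [DecidablePred (· ∈ {x | ∃ i < s, x ≡ d * i [MOD L]})] (k : ℕ) :
    s ≤ Nat.count (fun i => k * L + i ∈ {x | ∃ i < s, x ≡ d * i [MOD L]}) L := by
  rw [Nat.count_eq_card_filter_range]
  conv_lhs => rw [← Finset.card_range s]
  refine Finset.card_le_card_of_injOn (fun j => (0 + d * j) % L) ?_ ?_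
  · intro j hj
    simp only [Finset.coe_filter, Finset.mem_range, Set.mem_ofPred_eq, Finset.coe_range,
      Set.mem_Iio] at hj ⊢
    exact ⟨Nat.mod_lt _ hL, j, hj, by simp [Nat.ModEq]⟩
  · exact (injOn_add_mul_mod hcop 0).mono (by simpa using hsL)

end OddDifference

/-- Theorem B (Gupta–Tripathi): For `M = {a, a+d, …, a+(n-1)d}` with `gcd(a,d) = 1` and
`n > 1`, `μ(M) = (2a + (n-1)(d-1))/(2(2a + (n-1)d))` if `d` is odd, and `μ(M) = 1/2`
if `d` is even. -/
theorem stmt16 (a d n : ℕ) (ha : 0 < a) (hd : 0 < d) (hn : 1 < n)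
    (hgcd : Nat.gcd a d = 1)
    (M : Set ℕ) (hM : M = {m | ∃ k < n, m = a + k * d}) :
    (Odd d → muM M =
      (2 * (a : ℝ) + ((n : ℝ) - 1) * ((d : ℝ) - 1)) /
        (2 * (2 * (a : ℝ) + ((n : ℝ) - 1) * (d : ℝ)))) ∧
    (Even d → muM M = 1 / 2) := by
  classical
  subst hM
  refine ⟨?_, fun he => ?_⟩
  · rintro ⟨t, rfl⟩
    obtain ⟨m, rfl⟩ : ∃ m, n = m + 1 := ⟨n - 1, by omega⟩
    have hL : 0 < 2 * a + m * (2 * t + 1) := by omega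
    have hLs : 2 * a + m * (2 * t + 1) = 2 * (a + m * t) + (m + 1 - 1) := by
      rw [Nat.add_sub_cancel]; ring
    have hds : (2 * t + 1) * (a + m * t) = t * (2 * a + m * (2 * t + 1)) + a := by ring
    have hcop : Nat.Coprime (2 * a + m * (2 * t + 1)) (2 * t + 1) := by
      rw [Nat.coprime_add_mul_right_left]
      exact Nat.Coprime.mul_left (by simp) hgcd
    rw [muM_eq_of_windows _ _ (a + m * t) hL
      (fun S _ hS b => hS.count_le (Nat.succ_pos m) hL rfl hLs hds hcop b) _
      (isMSet_residues ha hLs hds hcop)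
      (le_count_residues hL (by omega) hcop)]
    have hL' : (0 : ℝ) < 2 * a + m * (2 * t + 1) := by exact_mod_cast hL
    push_cast
    rw [div_eq_div_iff hL'.ne' (by simpa using hL'.ne')]
    ring
  · have hao : Odd a := by
      rw [← Nat.not_even_iff_odd]
      intro hae
      have := Nat.dvd_gcd hae.two_dvd he.two_dvd
      omega
    have key : ∀ k, a ≤ Nat.count (fun i => k * (2 * a) + i ∈ {x : ℕ | Even x}) (2 * a) := by
      intro k
      rw [Nat.count_eq_card_filter_range]
      conv_lhs => rw [← Finset.card_range a]
      refine Finset.card_le_card_of_injOn (fun j => 2 * j) ?_ ?_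
      · intro j hj
        simp only [Finset.coe_filter, Finset.mem_range, Set.mem_ofPred_eq, Finset.coe_range,
          Set.mem_Iio] at hj ⊢
        exact ⟨by omega, by simp [parity_simps]⟩
      · intro i _ j _ hij
        simpa using hij
    rw [muM_eq_of_windows _ (2 * a) a (by omega)
      (fun S _ hS b => hS.count_two_mul_le (m := a) (show ∃ k < n, a = a + k * d from ⟨0, by omega, by simp⟩) b) {x : ℕ | Even x} ?_ key]
    · have : (a : ℝ) ≠ 0 := by positivity
      push_cast
      field_simp
    · rintro x hx y hy ⟨k, -, hk⟩
      have h1 : Odd (a + k * d) := hao.add_even (he.mul_left k)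
      rw [← hk, ← Nat.not_even_iff_odd] at h1
      exact h1 (Even.tsub hx hy)
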